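/- Assume λ_N^W > −1 and 0 < α < (1+λ_N^W)/(μ+L). Then for every k ≥ 0 the D-SG iterates satisfy E[‖x^{(k)} − x^∞‖²] ≤ (1−αμ)^{2k} ‖x^{(0)} − x^∞‖² + α σ² N (1 − (1−αμ)^{2k})/(μ(2−αμ)). If in addition α ≤ 1/(L+μ) and ‖x^∞ − x^*‖ ≤ √N C₁ α/(1−γ), then for every k ≥ 0, E[‖x^{(k)} − x^*‖²] ≤ 2(1−αμ)^{2k} ‖x^{(0)} − x^∞‖² + 2α σ² N (1 − (1−αμ)^{2k})/(μ(2−αμ)) + 2α²C₁²N/(1−γ)². -/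

import Mathlib

open MeasureTheory Filter Real ProbabilityTheory
open scoped RealInnerProductSpace ENNReal NNReal Matrix

theorem norm_sub_sq_le_mul_inner_of_quadratic_bounds {E : Type*} [NormedAddCommGroup E]
    [InnerProductSpace ℝ E] {h : E → ℝ} {p : E → E} {l : ℝ} (hl : 0 ≤ l)
    (hlow : ∀ x y, h x + ⟪p x, y - x⟫ ≤ h y)
    (hupp : ∀ x y, h y ≤ h x + ⟪p x, y - x⟫ + l / 2 * ‖y - x‖ ^ 2) (x y : E) :
    ‖p x - p y‖ ^ 2 ≤ l * ⟪p x - p y, x - y⟫ := by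
  have key : ∀ t : ℝ, ∀ x y,
      h x + ⟪p x, y - x⟫ + (t - l / 2 * t ^ 2) * ‖p y - p x‖ ^ 2 ≤ h y := by
    intro t x y
    have h1 := hlow x (y - t • (p y - p x))
    have h2 := hupp y (y - t • (p y - p x))
    have e1 : y - t • (p y - p x) - x = (y - x) - t • (p y - p x) := by abel
    have e2 : y - t • (p y - p x) - y = - (t • (p y - p x)) := by abel
    rw [e1, inner_sub_right, inner_smul_right] at h1
    rw [e2, inner_neg_right, inner_smul_right, norm_neg, norm_smul, mul_pow, Real.norm_eq_abs,
      sq_abs] at h2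
    have h3 : ⟪p y, p y - p x⟫ - ⟪p x, p y - p x⟫ = ‖p y - p x‖ ^ 2 := by
      rw [← inner_sub_left, real_inner_self_eq_norm_sq]
    linear_combination h1 + h2 - t * h3
  have hsymm : ∀ t : ℝ, (2 * t - l * t ^ 2) * ‖p x - p y‖ ^ 2 ≤ ⟪p x - p y, x - y⟫ := by
    intro t
    have h1 := key t x y
    have h2 := key t y x
    have h3 : ⟪p x, y - x⟫ = - ⟪p x, x - y⟫ := by rw [← inner_neg_right, neg_sub]
    rw [norm_sub_rev, h3] at h1
    rw [inner_sub_left]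
    linarith
  rcases hl.eq_or_lt with rfl | hl
  · by_contra! hpos
    rw [zero_mul] at hpos
    have h1 := hsymm ((⟪p x - p y, x - y⟫ + 1) / (2 * ‖p x - p y‖ ^ 2))
    have h2 : (2 * ((⟪p x - p y, x - y⟫ + 1) / (2 * ‖p x - p y‖ ^ 2))
      - 0 * ((⟪p x - p y, x - y⟫ + 1) / (2 * ‖p x - p y‖ ^ 2)) ^ 2) * ‖p x - p y‖ ^ 2
        = ⟪p x - p y, x - y⟫ + 1 := by
      have h3 := hpos.ne'
      generalize ‖p x - p y‖ ^ 2 = q at h3 ⊢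
      field_simp
      ring
    linarith
  · have h1 := mul_le_mul_of_nonneg_left (hsymm (1 / l)) hl.le
    have h2 : l * ((2 * (1 / l) - l * (1 / l) ^ 2) * ‖p x - p y‖ ^ 2) = ‖p x - p y‖ ^ 2 := by
      field_simp
      ring
    linarith

section FirstOrder

variable {E : Type*} [NormedAddCommGroup E] [InnerProductSpace ℝ E] [CompleteSpace E]

theorem HasGradientAt.hasDerivAt_comp_line {f : E → ℝ} {g x v : E} {t : ℝ}
    (h : HasGradientAt f g (x + t • v)) :
    HasDerivAt (fun s : ℝ => f (x + s • v)) ⟪g, v⟫ t := by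
  have h1 : HasDerivAt (fun s : ℝ => x + s • v) v t := by
    simpa using ((hasDerivAt_id t).smul_const v).const_add x
  exact h.hasFDerivAt.comp_hasDerivAt t h1 |>.congr_deriv (by simp)

theorem ConvexOn.add_inner_gradient_le {h : E → ℝ} (hc : ConvexOn ℝ Set.univ h) {p x : E}
    (hp : HasGradientAt h p x) (y : E) : h x + ⟪p, y - x⟫ ≤ h y := by
  have hc' : ConvexOn ℝ Set.univ (fun s : ℝ => h (x + s • (y - x))) := by
    have := hc.comp_affineMap (AffineMap.lineMap x y : ℝ →ᵃ[ℝ] E)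
    simpa [Function.comp_def, AffineMap.lineMap_apply, add_comm] using this
  have hd : HasDerivAt (fun s : ℝ => h (x + s • (y - x))) ⟪p, y - x⟫ 0 :=
    HasGradientAt.hasDerivAt_comp_line (by simpa using hp)
  have := hc'.le_slope_of_hasDerivAt (Set.mem_univ 0) (Set.mem_univ 1) one_pos hd
  simp [slope_def_field] at this
  linarith

theorem le_add_inner_add_sq_of_lipschitz_gradient {f : E → ℝ} {g : E → E} {L : ℝ}
    (hf : ∀ x, HasGradientAt f (g x) x) (hg : ∀ x y, ‖g x - g y‖ ≤ L * ‖x - y‖) (x y : E) :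
    f y ≤ f x + ⟪g x, y - x⟫ + L / 2 * ‖y - x‖ ^ 2 := by
  set v := y - x with hv
  have hd : ∀ t : ℝ, HasDerivAt
      (fun s : ℝ => f (x + s • v) - s * ⟪g x, v⟫ - L / 2 * ‖v‖ ^ 2 * s ^ 2)
      (⟪g (x + t • v), v⟫ - ⟪g x, v⟫ - L * ‖v‖ ^ 2 * t) t := by
    intro t
    have h1 := (hf (x + t • v)).hasDerivAt_comp_line
    have h2 := (hasDerivAt_id t).mul_const ⟪g x, v⟫
    have h3 := ((hasDerivAt_id t).pow 2).const_mul (L / 2 * ‖v‖ ^ 2)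
    refine ((h1.sub h2).sub h3).congr_deriv ?_
    simp
    ring
  have hanti := antitoneOn_of_hasDerivWithinAt_nonpos (convex_Icc (0 : ℝ) 1)
    (fun t _ => (hd t).continuousAt.continuousWithinAt)
    (fun t _ => (hd t).hasDerivWithinAt) (fun t ht => by
      rw [interior_Icc] at ht
      have h1 : ⟪g (x + t • v) - g x, v⟫ ≤ ‖g (x + t • v) - g x‖ * ‖v‖ := real_inner_le_norm _ _
      have h2 := hg (x + t • v) x
      rw [add_sub_cancel_left, norm_smul, Real.norm_of_nonneg ht.1.le] at h2
      have h3 := mul_le_mul_of_nonneg_right h2 (norm_nonneg v)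
      rw [inner_sub_left] at h1
      nlinarith)
  have := hanti (Set.left_mem_Icc.2 zero_le_one) (Set.right_mem_Icc.2 zero_le_one) zero_le_one
  simp only [one_smul, zero_smul, add_zero, hv, add_sub_cancel] at this
  norm_num at this
  rw [hv]
  linarith

theorem HasGradientAt.sub_half_mul_norm_sq {f : E → ℝ} {g x : E} (hf : HasGradientAt f g x)
    (μ : ℝ) : HasGradientAt (fun x => f x - μ / 2 * ‖x‖ ^ 2) (g - μ • x) x := by
  rw [hasGradientAt_iff_hasFDerivAt]
  refine (hf.hasFDerivAt.sub
    ((hasStrictFDerivAt_norm_sq x).hasFDerivAt.const_mul (μ / 2))).congr_fderiv ?_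
  ext v
  simp
  ring

theorem inner_shifted_gradient_sub_nonneg {f : E → ℝ} {g : E → E} {μ : ℝ}
    (hf : ∀ x, HasGradientAt f (g x) x)
    (hc : ConvexOn ℝ Set.univ (fun x => f x - μ / 2 * ‖x‖ ^ 2)) (x y : E) :
    0 ≤ ⟪g x - g y - μ • (x - y), x - y⟫ := by
  have h1 := hc.add_inner_gradient_le ((hf x).sub_half_mul_norm_sq μ) y
  have h2 := hc.add_inner_gradient_le ((hf y).sub_half_mul_norm_sq μ) x
  have h3 : ⟪g x - μ • x, y - x⟫ = - ⟪g x - μ • x, x - y⟫ := by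
    rw [← inner_neg_right, neg_sub]
  have e : g x - g y - μ • (x - y) = g x - μ • x - (g y - μ • y) := by
    rw [smul_sub]; abel
  rw [e, inner_sub_left]
  linarith

theorem norm_shifted_gradient_sub_sq_le {f : E → ℝ} {g : E → E} {μ L : ℝ}
    (hμL : μ ≤ L) (hf : ∀ x, HasGradientAt f (g x) x)
    (hg : ∀ x y, ‖g x - g y‖ ≤ L * ‖x - y‖)
    (hc : ConvexOn ℝ Set.univ (fun x => f x - μ / 2 * ‖x‖ ^ 2)) (x y : E) :
    ‖g x - g y - μ • (x - y)‖ ^ 2 ≤ (L - μ) * ⟪g x - g y - μ • (x - y), x - y⟫ := by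
  have hupp : ∀ x y, f y - μ / 2 * ‖y‖ ^ 2 ≤ f x - μ / 2 * ‖x‖ ^ 2 + ⟪g x - μ • x, y - x⟫
      + (L - μ) / 2 * ‖y - x‖ ^ 2 := by
    intro x y
    have h1 := le_add_inner_add_sq_of_lipschitz_gradient hf hg x y
    have h2 : ‖y‖ ^ 2 = ‖x‖ ^ 2 + 2 * ⟪x, y - x⟫ + ‖y - x‖ ^ 2 := by
      rw [← norm_add_sq_real, add_sub_cancel]
    rw [inner_sub_left, inner_smul_left, h2]
    simp only [conj_trivial]
    linarith
  have := norm_sub_sq_le_mul_inner_of_quadratic_bounds (sub_nonneg.2 hμL)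
    (fun x y => hc.add_inner_gradient_le ((hf x).sub_half_mul_norm_sq μ) y) hupp x y
  have e : g x - μ • x - (g y - μ • y) = g x - g y - μ • (x - y) := by
    rw [smul_sub]; abel
  rwa [e] at this

end FirstOrder

section Spectral

variable {E : Type*} [NormedAddCommGroup E] [InnerProductSpace ℝ E] {n : Type*} [Fintype n]
  [DecidableEq n]

theorem sum_inner_sum_smul_of_mul_transpose_eq_one {V : Matrix n n ℝ} (hV : V * Vᵀ = 1)
    (a b : n → E) :
    ∑ i, ⟪∑ k, V k i • a k, ∑ l, V l i • b l⟫ = ∑ k, ⟪a k, b k⟫ := by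
  have h : ∀ k l, ∑ i, V k i * V l i = if k = l then 1 else 0 := fun k l => by
    rw [← Matrix.one_apply, ← hV, Matrix.mul_apply]; rfl
  simp_rw [sum_inner, inner_sum, inner_smul_left, inner_smul_right, conj_trivial, ← mul_assoc]
  rw [Finset.sum_comm]
  refine Finset.sum_congr rfl fun k _ => ?_
  rw [Finset.sum_comm]
  simp_rw [← Finset.sum_mul, h]
  simp

theorem sum_sub_sum_smul_bounds {W V : Matrix n n ℝ} {lam : n → ℝ} {c : ℝ} (hV : V * Vᵀ = 1)
    (hW : W = Vᵀ * Matrix.diagonal lam * V) (h1 : ∀ k, lam k ≤ 1) (hc : ∀ k, c ≤ lam k)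
    (z : n → E) :
    0 ≤ ∑ i, ⟪z i, z i - ∑ j, W i j • z j⟫ ∧
    ∑ i, ‖z i - ∑ j, W i j • z j‖ ^ 2 ≤ (1 - c) * ∑ i, ⟪z i, z i - ∑ j, W i j • z j⟫ := by
  set u : n → E := fun k => ∑ j, V k j • z j with hu
  have hV' : ∀ i j, ∑ k, V k i * V k j = if i = j then 1 else 0 := fun i j => by
    rw [← Matrix.one_apply, ← mul_eq_one_comm.1 hV, Matrix.mul_apply]; rfl
  have hz : ∀ i, z i = ∑ k, V k i • u k := by
    intro i
    simp_rw [hu, Finset.smul_sum, smul_smul]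
    rw [Finset.sum_comm]
    simp_rw [← Finset.sum_smul, hV']
    simp
  have hWz : ∀ i, z i - ∑ j, W i j • z j = ∑ k, V k i • ((1 - lam k) • u k) := by
    intro i
    have : ∑ j, W i j • z j = ∑ k, V k i • (lam k • u k) := by
      have hWij : ∀ i j, W i j = ∑ k, V k i * lam k * V k j := fun i j => by
        rw [hW, Matrix.mul_apply]
        simp [Matrix.mul_diagonal]
      simp_rw [hu, hWij, Finset.smul_sum, smul_smul, Finset.sum_smul]
      rw [Finset.sum_comm]
      simp_rw [mul_assoc]
    rw [this]
    nth_rewrite 1 [hz i]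
    rw [← Finset.sum_sub_distrib]
    simp_rw [sub_smul, smul_sub, one_smul]
  have hinner : ∑ i, ⟪z i, z i - ∑ j, W i j • z j⟫ = ∑ k, (1 - lam k) * ‖u k‖ ^ 2 := by
    simp_rw [hWz]
    conv_lhs => enter [2, i]; rw [hz i]
    rw [sum_inner_sum_smul_of_mul_transpose_eq_one hV]
    simp_rw [inner_smul_right, real_inner_self_eq_norm_sq]
  have hnorm : ∑ i, ‖z i - ∑ j, W i j • z j‖ ^ 2 = ∑ k, (1 - lam k) ^ 2 * ‖u k‖ ^ 2 := by
    simp_rw [hWz, ← real_inner_self_eq_norm_sq]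
    rw [sum_inner_sum_smul_of_mul_transpose_eq_one hV]
    simp_rw [inner_smul_right, inner_smul_left, conj_trivial]
    exact Finset.sum_congr rfl fun k _ => by ring
  rw [hinner, hnorm, Finset.mul_sum]
  refine ⟨Finset.sum_nonneg fun k _ => mul_nonneg (sub_nonneg.2 (h1 k)) (sq_nonneg _),
    Finset.sum_le_sum fun k _ => ?_⟩
  rw [sq, mul_assoc]
  exact mul_le_mul_of_nonneg_right (by linarith [hc k])
    (mul_nonneg (sub_nonneg.2 (h1 k)) (sq_nonneg _))

end Spectral

theorem norm_add_sq_le_of_cocoercive {H : Type*} [NormedAddCommGroup H] [InnerProductSpace ℝ H]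
    {a b z : H} {c₁ c₂ : ℝ} (hc₁ : 0 ≤ c₁) (hc₂ : 0 ≤ c₂) (ha0 : 0 ≤ ⟪z, a⟫) (hb0 : 0 ≤ ⟪z, b⟫)
    (ha : ‖a‖ ^ 2 ≤ c₁ * ⟪z, a⟫) (hb : ‖b‖ ^ 2 ≤ c₂ * ⟪z, b⟫) :
    ‖a + b‖ ^ 2 ≤ (c₁ + c₂) * ⟪z, a + b⟫ := by
  have h1 : 2 * (‖a‖ * ‖b‖) ≤ c₁ * ⟪z, b⟫ + c₂ * ⟪z, a⟫ := by
    refine abs_le_of_sq_le_sq' ?_ (by positivity) |>.2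
    have := mul_le_mul ha hb (sq_nonneg _) (by positivity)
    nlinarith [sq_nonneg (c₁ * ⟪z, b⟫ - c₂ * ⟪z, a⟫)]
  rw [norm_add_sq_real, inner_add_right]
  linarith [real_inner_le_norm a b]

theorem MeasureTheory.MemLp.integrable_real_inner {Ω H : Type*} {mΩ : MeasurableSpace Ω}
    {P : Measure Ω} [NormedAddCommGroup H] [InnerProductSpace ℝ H] {Y w : Ω → H} (hY : MemLp Y 2 P)
    (hw : MemLp w 2 P) : Integrable (fun ω => ⟪Y ω, w ω⟫) P := by
  refine Integrable.mono' (hY.norm.integrable_mul hw.norm) (hY.1.inner hw.1)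
    (ae_of_all _ fun ω => ?_)
  exact norm_inner_le_norm _ _

section Stochastic

variable {Ω : Type*} {m mΩ : MeasurableSpace Ω} {P : Measure Ω}
  {H : Type*} [NormedAddCommGroup H] [InnerProductSpace ℝ H] [CompleteSpace H]

theorem integral_inner_eq_zero_of_condExp_eq_zero [IsFiniteMeasure P] (hm : m ≤ mΩ)
    {Y w : Ω → H} (hYm : StronglyMeasurable[m] Y) (hY : MemLp Y 2 P) (hw : MemLp w 2 P)
    (hmean : P[w|m] =ᵐ[P] 0) : ∫ ω, ⟪Y ω, w ω⟫ ∂P = 0 := by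
  have h := condExp_bilin_of_stronglyMeasurable_left (μ := P) (innerSL ℝ (E := H)) hYm
    (hY.integrable_real_inner hw) (hw.integrable one_le_two)
  change P[fun ω => ⟪Y ω, w ω⟫|m] =ᵐ[P] fun ω => ⟪Y ω, (P[w|m]) ω⟫ at h
  rw [← integral_condExp hm, integral_congr_ae h]
  refine integral_eq_zero_of_ae ?_
  filter_upwards [hmean] with ω hω
  simp [hω]

theorem integral_norm_sub_smul_sq_le [IsProbabilityMeasure P] (hm : m ≤ mΩ)
    {Y w : Ω → H} {α s : ℝ} (hYm : StronglyMeasurable[m] Y) (hY : MemLp Y 2 P) (hw : MemLp w 2 P)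
    (hmean : P[w|m] =ᵐ[P] 0) (hvar : ∀ᵐ ω ∂P, (P[fun ω' => ‖w ω'‖ ^ 2|m]) ω ≤ s) :
    ∫ ω, ‖Y ω - α • w ω‖ ^ 2 ∂P ≤ ∫ ω, ‖Y ω‖ ^ 2 ∂P + α ^ 2 * s := by
  have hws : ∫ ω, ‖w ω‖ ^ 2 ∂P ≤ s := by
    rw [← integral_condExp hm]
    simpa using integral_mono_ae integrable_condExp (integrable_const s) hvar
  have hYi := hY.integrable_norm_pow two_ne_zero
  have hwi := hw.integrable_norm_pow two_ne_zero
  simp only at hYi hwi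
  have e : ∀ ω, ‖Y ω - α • w ω‖ ^ 2 = ‖Y ω‖ ^ 2 - 2 * α * ⟪Y ω, w ω⟫ + α ^ 2 * ‖w ω‖ ^ 2 := by
    intro ω
    rw [norm_sub_sq_real, inner_smul_right, norm_smul, mul_pow, Real.norm_eq_abs, sq_abs]
    ring
  have hi := (hY.integrable_real_inner hw).const_mul (2 * α)
  simp_rw [e]
  have hYwi : Integrable (fun ω => ‖Y ω‖ ^ 2 - 2 * α * ⟪Y ω, w ω⟫) P := hYi.sub hi
  rw [integral_add hYwi (hwi.const_mul _), integral_sub hYi hi, integral_const_mul,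
    integral_const_mul, integral_inner_eq_zero_of_condExp_eq_zero hm hYm hY hw hmean]
  have := mul_le_mul_of_nonneg_left hws (sq_nonneg α)
  linarith

theorem stochastic_contraction_bound [IsProbabilityMeasure P] {ℱ : ℕ → MeasurableSpace Ω}
    (hℱ : ∀ k, ℱ k ≤ mΩ) {X w : ℕ → Ω → H} {T : H → H} {xinf x0 : H} {α ρ s : ℝ}
    (hTc : Continuous T) (hT : ∀ x, ‖T x - xinf‖ ≤ ρ * ‖x - xinf‖)
    (hX0 : ∀ ω, X 0 ω = x0) (hX : ∀ k, StronglyMeasurable[ℱ k] (X k))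
    (hrec : ∀ k ω, X (k + 1) ω = T (X k ω) - α • w (k + 1) ω)
    (hw : ∀ k, MemLp (w (k + 1)) 2 P) (hmean : ∀ k, P[w (k + 1)|ℱ k] =ᵐ[P] 0)
    (hvar : ∀ k, ∀ᵐ ω ∂P, (P[fun ω' => ‖w (k + 1) ω'‖ ^ 2|ℱ k]) ω ≤ s) (k : ℕ) :
    MemLp (fun ω => X k ω - xinf) 2 P ∧
    ∫ ω, ‖X k ω - xinf‖ ^ 2 ∂P ≤
      (ρ ^ 2) ^ k * ‖x0 - xinf‖ ^ 2 + α ^ 2 * s * ∑ j ∈ Finset.range k, (ρ ^ 2) ^ j := by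
  induction k with
  | zero => simp [hX0, memLp_const]
  | succ k ih =>
    obtain ⟨hL, hb⟩ := ih
    have hYm : StronglyMeasurable[ℱ k] (fun ω => T (X k ω) - xinf) :=
      (hTc.comp_stronglyMeasurable (hX k)).sub stronglyMeasurable_const
    have hY : MemLp (fun ω => T (X k ω) - xinf) 2 P :=
      MemLp.of_le_mul hL (hYm.mono (hℱ k)).aestronglyMeasurable (ae_of_all _ fun ω => hT _)
    have e : ∀ ω, X (k + 1) ω - xinf = (T (X k ω) - xinf) - α • w (k + 1) ω := by
      intro ω
      rw [hrec]
      abel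
    simp_rw [e]
    refine ⟨hY.sub ((hw k).const_smul α), ?_⟩
    have h1 := integral_norm_sub_smul_sq_le (α := α) (hℱ k) hYm hY (hw k) (hmean k) (hvar k)
    have h2 : ∫ ω, ‖T (X k ω) - xinf‖ ^ 2 ∂P ≤ ρ ^ 2 * ∫ ω, ‖X k ω - xinf‖ ^ 2 ∂P := by
      rw [← integral_const_mul]
      refine integral_mono (hY.integrable_norm_pow two_ne_zero)
        ((hL.integrable_norm_pow two_ne_zero).const_mul _) fun ω => ?_
      simp only
      rw [← mul_pow]
      exact pow_le_pow_left₀ (norm_nonneg _) (hT _) 2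
    have h3 := mul_le_mul_of_nonneg_left hb (sq_nonneg ρ)
    rw [Finset.sum_range_succ', pow_zero]
    simp_rw [pow_succ (ρ ^ 2), ← Finset.sum_mul]
    linarith

end Stochastic

theorem integral_norm_sub_sq_le_two_mul {Ω : Type*} {mΩ : MeasurableSpace Ω} {P : Measure Ω}
    [IsProbabilityMeasure P] {H : Type*} [NormedAddCommGroup H] {X : Ω → H} {a b : H}
    (hX : MemLp (fun ω => X ω - a) 2 P) :
    ∫ ω, ‖X ω - b‖ ^ 2 ∂P ≤ 2 * ∫ ω, ‖X ω - a‖ ^ 2 ∂P + 2 * ‖a - b‖ ^ 2 := by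
  have hi : Integrable (fun ω => ‖X ω - a‖ ^ 2) P := hX.integrable_norm_pow two_ne_zero
  have hX' : MemLp (fun ω => X ω - b) 2 P := by
    refine (hX.add (memLp_const (a - b))).ae_eq (ae_of_all _ fun ω => ?_)
    simp
  calc ∫ ω, ‖X ω - b‖ ^ 2 ∂P ≤ ∫ ω, (2 * ‖X ω - a‖ ^ 2 + 2 * ‖a - b‖ ^ 2) ∂P := by
        refine integral_mono (hX'.integrable_norm_pow two_ne_zero)
          ((hi.const_mul 2).add (integrable_const _)) fun ω => ?_
        have h := norm_sub_le_norm_sub_add_norm_sub (X ω) a b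
        have h' := pow_le_pow_left₀ (norm_nonneg _) h 2
        simp only
        linarith [sq_nonneg (‖X ω - a‖ - ‖a - b‖)]
    _ = _ := by
        rw [integral_add (hi.const_mul 2) (integrable_const _), integral_const_mul]
        simp

section Mixing

variable {E : Type*} [NormedAddCommGroup E] [InnerProductSpace ℝ E] [CompleteSpace E]
  {n : Type*} [Fintype n]

/-- One noiseless step of decentralized gradient descent. -/
noncomputable def decentralizedGradientStep (W : Matrix n n ℝ) (α : ℝ) (g : n → E → E)
    (x : PiLp 2 (fun _ : n => E)) : PiLp 2 (fun _ : n => E) :=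
  WithLp.toLp 2 fun i => (∑ j, W i j • x j) - α • g i (x i)

theorem norm_decentralizedGradientStep_sub_le [DecidableEq n] {W V : Matrix n n ℝ} {lam : n → ℝ}
    {c α μ L : ℝ} (hV : V * Vᵀ = 1) (hW : W = Vᵀ * Matrix.diagonal lam * V)
    (h1 : ∀ k, lam k ≤ 1) (hc : ∀ k, c ≤ lam k) (hc1 : c ≤ 1) (hμL : μ ≤ L)
    (hα : 0 ≤ α) (hαL : α * (μ + L) ≤ 1 + c) (hαμ : 0 ≤ 1 - α * μ) {f : n → E → ℝ}
    {g : n → E → E} (hf : ∀ i x, HasGradientAt (f i) (g i x) x)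
    (hg : ∀ i x y, ‖g i x - g i y‖ ≤ L * ‖x - y‖)
    (hconv : ∀ i, ConvexOn ℝ Set.univ (fun x => f i x - μ / 2 * ‖x‖ ^ 2))
    (x y : PiLp 2 (fun _ : n => E)) :
    ‖decentralizedGradientStep W α g x - decentralizedGradientStep W α g y‖
      ≤ (1 - α * μ) * ‖x - y‖ := by
  set z := x - y with hz
  set a : PiLp 2 (fun _ : n => E) := WithLp.toLp 2 fun i => z i - ∑ j, W i j • z j with ha
  set b : PiLp 2 (fun _ : n => E) :=
    WithLp.toLp 2 fun i => α • (g i (x i) - g i (y i) - μ • z i) with hb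
  have hbi : ∀ i, ⟪z i, b i⟫ = α * ⟪g i (x i) - g i (y i) - μ • z i, z i⟫ := fun i => by
    rw [real_inner_comm]
    simp [hb, inner_smul_left]
  have hco : ∀ i, ‖g i (x i) - g i (y i) - μ • z i‖ ^ 2 ≤
      (L - μ) * ⟪g i (x i) - g i (y i) - μ • z i, z i⟫ := fun i =>
    norm_shifted_gradient_sub_sq_le hμL (hf i) (hg i) (hconv i) (x i) (y i)
  have hco0 : ∀ i, 0 ≤ ⟪g i (x i) - g i (y i) - μ • z i, z i⟫ := fun i =>
    inner_shifted_gradient_sub_nonneg (hf i) (hconv i) (x i) (y i)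
  obtain ⟨ha0, ha2⟩ := sum_sub_sum_smul_bounds hV hW h1 hc (fun i => z i)
  have hza : ⟪z, a⟫ = ∑ i, ⟪z i, z i - ∑ j, W i j • z j⟫ := PiLp.inner_apply _ _
  have hzb : ⟪z, b⟫ = ∑ i, α * ⟪g i (x i) - g i (y i) - μ • z i, z i⟫ := by
    rw [PiLp.inner_apply]
    exact Finset.sum_congr rfl fun i _ => hbi i
  have hb0 : 0 ≤ ⟪z, b⟫ := by
    rw [hzb]
    exact Finset.sum_nonneg fun i _ => mul_nonneg hα (hco0 i)
  have ha' : ‖a‖ ^ 2 ≤ (1 - c) * ⟪z, a⟫ := by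
    rw [PiLp.norm_sq_eq_of_L2, hza]
    exact ha2
  have hb' : ‖b‖ ^ 2 ≤ (α * (L - μ)) * ⟪z, b⟫ := by
    rw [PiLp.norm_sq_eq_of_L2, hzb, Finset.mul_sum]
    refine Finset.sum_le_sum fun i _ => ?_
    have e : ‖b i‖ ^ 2 = α ^ 2 * ‖g i (x i) - g i (y i) - μ • z i‖ ^ 2 := by
      simp [hb, norm_smul, mul_pow]
    rw [e]
    linarith [mul_le_mul_of_nonneg_left (hco i) (sq_nonneg α)]
  rw [← hza] at ha0
  have hab := norm_add_sq_le_of_cocoercive (sub_nonneg.2 hc1)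
    (mul_nonneg hα (sub_nonneg.2 hμL)) ha0 hb0 ha' hb'
  have hab0 : 0 ≤ ⟪z, a + b⟫ := by
    rw [inner_add_right]
    exact add_nonneg ha0 hb0
  have hstep : decentralizedGradientStep W α g x - decentralizedGradientStep W α g y
      = (1 - α * μ) • z - (a + b) := by
    ext i : 1
    simp only [decentralizedGradientStep, ha, hb, hz, PiLp.sub_apply, PiLp.add_apply,
      PiLp.smul_apply, smul_sub, Finset.sum_sub_distrib, sub_smul, one_smul, mul_smul]
    abel
  refine le_of_sq_le_sq ?_ (mul_nonneg hαμ (norm_nonneg _))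
  rw [hstep, norm_sub_sq_real, inner_smul_left, norm_smul, mul_pow, mul_pow, Real.norm_eq_abs,
    sq_abs, conj_trivial]
  have := mul_le_mul_of_nonneg_right
    (show 1 - c + α * (L - μ) ≤ 2 * (1 - α * μ) by linarith) hab0
  linarith

end Mixing

/-- **Corollary (D-SG, distance to the fixed point and to the optimizer).**
Assume `λ_N^W > −1` and `0 < α < (1+λ_N^W)/(μ+L)`.  Then for every `k ≥ 0` the D-SG iterates
satisfy `E[‖x^{(k)} − x^∞‖²] ≤ (1−αμ)^{2k}‖x^{(0)}−x^∞‖² + ασ²N(1−(1−αμ)^{2k})/(μ(2−αμ))`.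
If in addition `α ≤ 1/(L+μ)` and `‖x^∞ − x^*‖ ≤ √N C₁ α/(1−γ)`, then for every `k ≥ 0`,
`E‖x^{(k)} − x^*‖² ≤ 2(1−αμ)^{2k}‖x^{(0)}−x^∞‖² + 2ασ²N(1−(1−αμ)^{2k})/(μ(2−αμ))
  + 2α²C₁²N/(1−γ)²`. -/
theorem dsg_suboptimality_bound
    {N d : ℕ} (hN : 0 < N) (hd : 0 < d)
    (μ L α σ : ℝ) (hμ : 0 < μ) (hμL : μ ≤ L) (hσ : 0 ≤ σ)
    -- the symmetric doubly stochastic mixing matrix and its eigenvalues, in decreasing order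
    (W : Matrix (Fin N) (Fin N) ℝ)
    (hWsymm : W.IsSymm)
    (hWnonneg : ∀ i j, 0 ≤ W i j)
    (hWrow : ∀ i, ∑ j, W i j = 1)
    (hWcol : ∀ j, ∑ i, W i j = 1)
    (lam : Fin N → ℝ) (V : Matrix (Fin N) (Fin N) ℝ)
    (hV : V * Vᵀ = 1)
    (hWeig : W = Vᵀ * Matrix.diagonal lam * V)
    (hlamAnti : Antitone lam)
    (hlamTop : lam ⟨0, hN⟩ = 1)
    (lamN : ℝ) (hlamN : lamN = lam ⟨N - 1, Nat.sub_lt hN Nat.one_pos⟩)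
    (hlamNgt : -1 < lamN)
    -- γ = max{|λ₂|, |λ_N|} < 1 and a constant C₁ ≥ 0
    (γ C₁ : ℝ) (hγdef : ∀ h2 : 1 < N, γ = max |lam ⟨1, h2⟩| |lamN|)
    (hγ0 : 0 ≤ γ) (hγ1 : γ < 1) (hC₁ : 0 ≤ C₁)
    -- stepsize
    (hα0 : 0 < α) (hαlt : α < (1 + lamN) / (μ + L))
    -- the local objectives: μ-strongly convex with L-Lipschitz gradients
    (f : Fin N → EuclideanSpace ℝ (Fin d) → ℝ)
    (gradf : Fin N → EuclideanSpace ℝ (Fin d) → EuclideanSpace ℝ (Fin d))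
    (hgrad : ∀ i x, HasGradientAt (f i) (gradf i x) x)
    (hlip : ∀ i, LipschitzWith (Real.toNNReal L) (gradf i))
    (hconv : ∀ i, ConvexOn ℝ Set.univ (fun x => f i x - μ / 2 * ‖x‖ ^ 2))
    -- the minimizer x_* of f = (1/N)∑ f_i, and x^* = (x_*,…,x_*)
    (xstar : EuclideanSpace ℝ (Fin d))
    (hxstar : ∀ y, (1 / (N : ℝ)) * ∑ i, f i xstar ≤ (1 / (N : ℝ)) * ∑ i, f i y)
    (xstarN : PiLp 2 (fun _ : Fin N => EuclideanSpace ℝ (Fin d)))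
    (hxstarN : ∀ i, xstarN i = xstar)
    -- the fixed point x^∞ : solution of (I − 𝒲)x + α ∇F(x) = 0
    (xinf : PiLp 2 (fun _ : Fin N => EuclideanSpace ℝ (Fin d)))
    (hxinf : ∀ i, (xinf i - ∑ j, W i j • xinf j) + α • gradf i (xinf i) = 0)
    -- probability space, filtration and the D-SG iterates
    {Ω : Type} {mΩ : MeasurableSpace Ω} (P : Measure Ω) [IsProbabilityMeasure P]
    (ℱ : ℕ → MeasurableSpace Ω) (hℱ : ∀ k, ℱ k ≤ mΩ) (hℱmono : Monotone ℱ)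
    (X w : ℕ → Ω → PiLp 2 (fun _ : Fin N => EuclideanSpace ℝ (Fin d)))
    (x0 : PiLp 2 (fun _ : Fin N => EuclideanSpace ℝ (Fin d)))
    (hX0 : ∀ ω, X 0 ω = x0)
    (hXadapted : ∀ k, StronglyMeasurable[ℱ k] (X k))
    (hwmeas : ∀ k, StronglyMeasurable[ℱ (k + 1)] (w (k + 1)))
    (hrec : ∀ k ω i, X (k + 1) ω i =
      (∑ j, W i j • X k ω j) - α • gradf i (X k ω i) - α • w (k + 1) ω i)
    -- the gradient noise: conditionally centered with conditional variance ≤ σ²N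
    (hwmean : ∀ k, P[w (k + 1)|ℱ k] =ᵐ[P] 0)
    (hwL2 : ∀ k, Integrable (fun ω => ‖w (k + 1) ω‖ ^ 2) P)
    (hwvar : ∀ k, ∀ᵐ ω ∂P, (P[fun ω' => ‖w (k + 1) ω'‖ ^ 2|ℱ k]) ω ≤ σ ^ 2 * N) :
    (∀ k : ℕ,
      ∫ ω, ‖X k ω - xinf‖ ^ 2 ∂P ≤
        (1 - α * μ) ^ (2 * k) * ‖x0 - xinf‖ ^ 2 +
          α * σ ^ 2 * N * ((1 - (1 - α * μ) ^ (2 * k)) / (μ * (2 - α * μ)))) ∧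
    (α ≤ 1 / (L + μ) →
      ‖xinf - xstarN‖ ≤ Real.sqrt N * C₁ * α / (1 - γ) →
      ∀ k : ℕ,
        ∫ ω, ‖X k ω - xstarN‖ ^ 2 ∂P ≤
          2 * (1 - α * μ) ^ (2 * k) * ‖x0 - xinf‖ ^ 2 +
            2 * α * σ ^ 2 * N * ((1 - (1 - α * μ) ^ (2 * k)) / (μ * (2 - α * μ))) +
            2 * α ^ 2 * C₁ ^ 2 * N / (1 - γ) ^ 2) := by
  have hL : 0 < μ + L := by linarith
  have hlam1 : ∀ k, lam k ≤ 1 := fun k =>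
    hlamTop ▸ hlamAnti (Nat.zero_le _ : (⟨0, hN⟩ : Fin N) ≤ k)
  have hlamge : ∀ k, lamN ≤ lam k := fun k => by
    rw [hlamN]
    exact hlamAnti (Nat.le_sub_one_of_lt k.2)
  have hlamN1 : lamN ≤ 1 := (hlamge ⟨0, hN⟩).trans (hlam1 _)
  have hαL : α * (μ + L) ≤ 1 + lamN := ((lt_div_iff₀ hL).1 hαlt).le
  have hρ0 : 0 ≤ 1 - α * μ := by nlinarith
  have hlip' : ∀ i x y, ‖gradf i x - gradf i y‖ ≤ L * ‖x - y‖ := fun i x y => by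
    have := (hlip i).norm_sub_le x y
    rwa [Real.coe_toNNReal _ (hμ.le.trans hμL)] at this
  have hcontr := norm_decentralizedGradientStep_sub_le hV hWeig hlam1 hlamge hlamN1 hμL hα0.le
    hαL hρ0 hgrad hlip' hconv
  have hTc : Continuous (decentralizedGradientStep W α gradf) :=
    (LipschitzWith.of_dist_le_mul (K := ⟨1 - α * μ, hρ0⟩) fun x y => by
      rw [dist_eq_norm, dist_eq_norm]
      exact hcontr x y).continuous
  have hfix : decentralizedGradientStep W α gradf xinf = xinf := by
    ext i : 1
    have h := hxinf i
    rw [sub_add, sub_eq_zero] at h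
    exact h.symm
  have hT : ∀ x, ‖decentralizedGradientStep W α gradf x - xinf‖ ≤ (1 - α * μ) * ‖x - xinf‖ :=
    fun x => by simpa only [hfix] using hcontr x xinf
  have hrec' : ∀ k ω, X (k + 1) ω =
      decentralizedGradientStep W α gradf (X k ω) - α • w (k + 1) ω := fun k ω => by
    ext i : 1
    exact hrec k ω i
  have hw : ∀ k, MemLp (w (k + 1)) 2 P := fun k =>
    (memLp_two_iff_integrable_sq_norm ((hwmeas k).mono (hℱ _)).aestronglyMeasurable).2 (hwL2 k)
  have hmain := stochastic_contraction_bound hℱ hTc hT hX0 hXadapted hrec' hw hwmean hwvar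
  have hαμ2 : 0 < 2 - α * μ := by linarith
  have hgeom : ∀ k : ℕ, α ^ 2 * (σ ^ 2 * N) * ∑ j ∈ Finset.range k, ((1 - α * μ) ^ 2) ^ j =
      α * σ ^ 2 * N * ((1 - (1 - α * μ) ^ (2 * k)) / (μ * (2 - α * μ))) := fun k => by
    have h := geom_sum_mul ((1 - α * μ) ^ 2) k
    rw [← pow_mul] at h
    have e : 1 - (1 - α * μ) ^ (2 * k) =
        α * (∑ j ∈ Finset.range k, ((1 - α * μ) ^ 2) ^ j) * (μ * (2 - α * μ)) := by
      linear_combination h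
    rw [e, mul_div_cancel_right₀ _ (mul_pos hμ hαμ2).ne']
    ring
  have hfirst : ∀ k : ℕ, ∫ ω, ‖X k ω - xinf‖ ^ 2 ∂P ≤
      (1 - α * μ) ^ (2 * k) * ‖x0 - xinf‖ ^ 2 +
        α * σ ^ 2 * N * ((1 - (1 - α * μ) ^ (2 * k)) / (μ * (2 - α * μ))) := fun k => by
    rw [← hgeom k, pow_mul]
    exact (hmain k).2
  refine ⟨hfirst, fun _ hdist k => ?_⟩
  have h1 := integral_norm_sub_sq_le_two_mul (b := xstarN) (hmain k).1
  have h2 := pow_le_pow_left₀ (norm_nonneg _) hdist 2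
  rw [div_pow, mul_pow, mul_pow, Real.sq_sqrt (Nat.cast_nonneg N)] at h2
  have e : 2 * α ^ 2 * C₁ ^ 2 * N / (1 - γ) ^ 2 = 2 * (N * C₁ ^ 2 * α ^ 2 / (1 - γ) ^ 2) := by
    ring
  rw [e]
  linarith [hfirst k]
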